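/- arXiv:0811.3186 — 3 statements merged into one kernel-verified Lean document; each statement's English description precedes it below -/
import Mathlib

section
/- Let n ≥ 1 and let A ∈ Mₙ(F) be any n×n matrix over the field F = ℂ((t)) of formal Laurent series. Then there exists g ∈ GLₙ(F) such that the gauge transform B = Ga_g(A) = g A g⁻¹ − (∂_t g) g⁻¹ is in oper form: B_{j,i} = 0 for all j > i+1, and B_{i+1,i} ≠ 0 for all 1 ≤ i ≤ n−1. (This is the main theorem of the paper — every flat G-bundle on the punctured disc admits an oper structure — for the group G = GLₙ.) -/
open HahnSeries Matrix

noncomputable section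

/-- The formal derivative `∂ₜ` on the field `F = ℂ((t))` of formal Laurent series:
`∂ₜ (Σₙ aₙ tⁿ) = Σₙ n aₙ tⁿ⁻¹`. -/
def dt (f : LaurentSeries ℂ) : LaurentSeries ℂ where
  coeff := fun k => (k + 1 : ℤ) * f.coeff (k + 1)
  isPWO_support' := by
    apply Set.IsPWO.mono (f.isPWO_support'.image_of_monotone
      (f := fun k : ℤ => k - 1) (fun a b h => by simp only []; omega))
    intro k hk
    simp only [Function.mem_support, ne_eq] at hk
    refine ⟨k + 1, ?_, by ring⟩
    simp only [Function.mem_support, ne_eq]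
    intro h
    exact hk (by rw [h, mul_zero])

/-- The gaugeGL action of `GLₙ(F)` on `Mₙ(F)`:  `Ga_g(A) = g A g⁻¹ - (∂ₜ g) g⁻¹`. -/
def gaugeGL {n : ℕ} (g : GL (Fin n) (LaurentSeries ℂ))
    (A : Matrix (Fin n) (Fin n) (LaurentSeries ℂ)) : Matrix (Fin n) (Fin n) (LaurentSeries ℂ) :=
  (g : Matrix (Fin n) (Fin n) (LaurentSeries ℂ)) * A *
      ((g⁻¹ : GL (Fin n) (LaurentSeries ℂ)) : Matrix (Fin n) (Fin n) (LaurentSeries ℂ)) -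
    ((g : Matrix (Fin n) (Fin n) (LaurentSeries ℂ)).map dt) *
      ((g⁻¹ : GL (Fin n) (LaurentSeries ℂ)) : Matrix (Fin n) (Fin n) (LaurentSeries ℂ))

/-- A matrix `B ∈ Mₙ(F)` is in oper form if all entries strictly below the subdiagonal
vanish and all subdiagonal entries are nonzero. -/
def IsOperForm {n : ℕ} (B : Matrix (Fin n) (Fin n) (LaurentSeries ℂ)) : Prop :=
  (∀ i j : Fin n, (j : ℕ) + 1 < (i : ℕ) → B i j = 0) ∧
  (∀ i j : Fin n, (i : ℕ) = (j : ℕ) + 1 → B i j ≠ 0)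

open Polynomial

section Connection

variable {R : Type*} [CommRing R] {ι : Type*} [Fintype ι]

/-- The connection `v ↦ v A + ∂v` on row vectors attached to an operator `∂` and a matrix `A`. -/
def rowConnection (d : R → R) (A : Matrix ι ι R) (v : ι → R) : ι → R :=
  fun l => (v ᵥ* A) l + d (v l)

variable [Algebra ℤ R]

lemma rowConnection_add (d : Derivation ℤ R R) (A : Matrix ι ι R) (v w : ι → R) :
    rowConnection d A (v + w) = rowConnection d A v + rowConnection d A w := by
  ext l
  simp only [rowConnection, add_vecMul, Pi.add_apply, map_add]
  ring

lemma rowConnection_smul (d : Derivation ℤ R R) (A : Matrix ι ι R) (c : R) (v : ι → R) :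
    rowConnection d A (c • v) = c • rowConnection d A v + d c • v := by
  ext l
  simp only [rowConnection, smul_vecMul, Pi.add_apply, Pi.smul_apply, smul_eq_mul,
    Derivation.leibniz]
  ring

lemma iterate_rowConnection_add (d : Derivation ℤ R R) (A : Matrix ι ι R) (i : ℕ) (v w : ι → R) :
    (rowConnection d A)^[i] (v + w) = (rowConnection d A)^[i] v + (rowConnection d A)^[i] w := by
  induction i generalizing v w with
  | zero => rfl
  | succ i ih => simp only [Function.iterate_succ_apply, rowConnection_add, ih]

lemma map_iterate_rowConnection {S : Type*} [CommRing S] [Algebra ℤ S] (φ : R →+* S) {d : Derivation ℤ R R}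
    {d' : Derivation ℤ S S} (h : ∀ r, φ (d r) = d' (φ r)) (A : Matrix ι ι R) (i : ℕ) (v : ι → R) :
    φ ∘ (rowConnection d A)^[i] v = (rowConnection d' (A.map φ))^[i] (φ ∘ v) := by
  induction i generalizing v with
  | zero => rfl
  | succ i ih =>
    rw [Function.iterate_succ_apply, Function.iterate_succ_apply, ih]
    congr 1
    ext l
    simp only [rowConnection, Function.comp_apply, map_add, h, RingHom.map_vecMul]

/-- If `∂x = 1`, then applying the connection `i` times to `x ^ (k + i) • v` lowers the order of
vanishing in `x` by exactly `i`, and multiplies the leading term by a nonzero integer. -/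
lemma exists_iterate_rowConnection_pow_smul {d : Derivation ℤ R R} {x : R} (hx : d x = 1)
    (A : Matrix ι ι R) (i k : ℕ) :
    ∃ c : ℕ, c ≠ 0 ∧ ∀ v : ι → R, ∃ w : ι → R,
      (rowConnection d A)^[i] (x ^ (k + i) • v) = x ^ k • (c • v + x • w) := by
  induction i generalizing k with
  | zero => exact ⟨1, one_ne_zero, fun v => ⟨0, by simp⟩⟩
  | succ i ih =>
    obtain ⟨c, hc, hw⟩ := ih (k + 1)
    refine ⟨(k + 1) * c, by positivity, fun v => ?_⟩
    obtain ⟨w, h⟩ := hw v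
    refine ⟨(k + 1) • w + rowConnection d A (c • v + x • w), ?_⟩
    rw [Function.iterate_succ_apply', show k + (i + 1) = k + 1 + i by ring, h,
      rowConnection_smul, Derivation.leibniz_pow, hx]
    ext l
    simp only [Pi.add_apply, Pi.smul_apply, ← Nat.cast_smul_eq_nsmul R, smul_eq_mul,
      Nat.add_sub_cancel]
    push_cast
    ring

end Connection

section CyclicVector

variable {K : Type*} [Field K] [CharZero K] {ι : Type*} [Fintype ι]

/-- For the derivation of `K[X]` extending that of `K` with `X′ = 1`, the constant terms of the
iterates of a connection on a polynomial vector can be prescribed arbitrarily. -/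
lemma exists_polynomial_iterate_rowConnection_eval_zero [Differential K] (A : Matrix ι ι K[X]) (e : ℕ → ι → K)
    (m : ℕ) : ∃ P : ι → K[X], ∀ i < m, ∀ l,
      ((rowConnection (Differential.implicitDeriv 1) A)^[i] P l).eval 0 = e i l := by
  induction m with
  | zero => exact ⟨0, by simp⟩
  | succ m ih =>
    obtain ⟨P, hP⟩ := ih
    set D := rowConnection (Differential.implicitDeriv (1 : K[X])) A with hD
    have hX : Differential.implicitDeriv (1 : K[X]) X = 1 := Differential.implicitDeriv_X _
    have key := exists_iterate_rowConnection_pow_smul hX A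
    obtain ⟨c, hc, hlead⟩ := key m 0
    have hc' : (c : K) ≠ 0 := Nat.cast_ne_zero.mpr hc
    let v : ι → K[X] := fun l => C ((e m l - (D^[m] P l).eval 0) / c)
    refine ⟨P + (X : K[X]) ^ m • v, fun i hi l => ?_⟩
    rw [hD, iterate_rowConnection_add, ← hD, Pi.add_apply, eval_add]
    rcases Nat.lt_succ_iff_lt_or_eq.mp hi with hi | rfl
    · obtain ⟨b, -, hb⟩ := key i (m - i)
      obtain ⟨w, hw⟩ := hb v
      rw [Nat.sub_add_cancel hi.le, ← hD] at hw
      rw [hw, hP i hi l]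
      simp [Nat.sub_ne_zero_of_lt hi]
    · obtain ⟨w, hw⟩ := hlead v
      rw [zero_add, ← hD] at hw
      rw [hw]
      rw [pow_zero, one_smul]
      simp only [v, Pi.add_apply, Pi.smul_apply, ← Nat.cast_smul_eq_nsmul K[X],
        smul_eq_mul, eval_add, eval_mul, eval_natCast, eval_C, eval_X, zero_mul, add_zero]
      field_simp
      ring

/-- The cyclic vector theorem: over a field of characteristic zero with a derivation and an
element of derivative `1`, every connection has a cyclic vector. -/
theorem exists_cyclic_vector {n : ℕ} (d : K →+ K)
    (hd : ∀ a b, d (a * b) = a * d b + b * d a) {x : K} (hx : d x = 1)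
    (A : Matrix (Fin n) (Fin n) K) :
    ∃ v : Fin n → K, IsUnit (Matrix.of fun i : Fin n => (rowConnection d A)^[i] v) := by
  let _ : Differential K := ⟨Derivation.mk' d.toIntLinearMap hd⟩
  have hx : Differential.deriv x = 1 := hx
  change ∃ v : Fin n → K,
    IsUnit (Matrix.of fun i : Fin n => (rowConnection Differential.deriv A)^[i] v)
  obtain ⟨P, hP⟩ := exists_polynomial_iterate_rowConnection_eval_zero (A.map (C : K →+* K[X]))
    (fun i l => if i = (l : ℕ) then 1 else 0) n
  let M : Matrix (Fin n) (Fin n) K[X] := Matrix.of fun i : Fin n =>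
    (rowConnection (Differential.implicitDeriv 1) (A.map (C : K →+* K[X])))^[i] P
  have hM : M.det ≠ 0 := by
    intro h
    have h1 : M.map (evalRingHom (0 : K)) = 1 := by
      ext i l
      simp [M, hP i i.2 l, Matrix.one_apply, Fin.ext_iff]
    have h2 := (evalRingHom (0 : K)).map_det M
    rw [RingHom.mapMatrix_apply, h1, h] at h2
    simp at h2
  obtain ⟨a, ha⟩ : ∃ a : ℕ, M.det.eval (x + a) ≠ 0 := by
    by_contra! h
    refine hM (Polynomial.eq_zero_of_infinite_isRoot _ (Set.Infinite.mono ?_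
      (Set.infinite_range_of_injective (f := fun a : ℕ => x + (a : K)) ?_)))
    · rintro _ ⟨a, rfl⟩
      exact h a
    · intro a b hab
      simpa using hab
  have hy : Differential.deriv (x + (a : K)) = 1 := by simp [hx]
  have hcomm : ∀ p : K[X], evalRingHom (x + (a : K)) (Differential.implicitDeriv 1 p) =
      Differential.deriv (evalRingHom (x + (a : K)) p) := by
    intro p
    have := Differential.deriv_aeval_eq_implicitDeriv (x + (a : K)) 1 (by simpa using hy) p
    simpa [coe_aeval_eq_eval] using this.symm
  refine ⟨evalRingHom (x + (a : K)) ∘ P, ?_⟩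
  have hA : (A.map (C : K →+* K[X])).map (evalRingHom (x + (a : K))) = A := by
    ext i j
    simp
  have hMa : (Matrix.of fun i : Fin n => (rowConnection Differential.deriv A)^[i]
      (evalRingHom (x + (a : K)) ∘ P)) = (evalRingHom (x + (a : K))).mapMatrix M := by
    ext i l
    have := map_iterate_rowConnection (evalRingHom (x + (a : K))) hcomm (A.map C) i P
    rw [hA] at this
    exact (congrFun this l).symm
  rw [hMa, Matrix.isUnit_iff_isUnit_det, ← RingHom.map_det, isUnit_iff_ne_zero]
  exact ha

end CyclicVector

section LaurentSeries

lemma dt_coeff (f : LaurentSeries ℂ) (k : ℤ) :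
    (dt f).coeff k = (k + 1 : ℤ) * f.coeff (k + 1) := rfl

lemma dt_add (f g : LaurentSeries ℂ) : dt (f + g) = dt f + dt g := by
  ext k
  simp only [dt_coeff, HahnSeries.coeff_add, mul_add]

lemma coeff_single_one_mul_dt (f : LaurentSeries ℂ) (k : ℤ) :
    (HahnSeries.single (1 : ℤ) (1 : ℂ) * dt f).coeff k = k * f.coeff k := by
  simp [coeff_single_mul, dt_coeff]

lemma dt_mul (f g : LaurentSeries ℂ) : dt (f * g) = f * dt g + g * dt f := by
  have ht : HahnSeries.single (1 : ℤ) (1 : ℂ) ≠ 0 := by simp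
  have hsupp : ∀ h : LaurentSeries ℂ, (HahnSeries.single (1 : ℤ) (1 : ℂ) * dt h).support ⊆ h.support := by
    intro h k hk hk'
    exact hk (by rw [coeff_single_one_mul_dt, hk', mul_zero])
  refine mul_left_cancel₀ ht ?_
  rw [mul_add, mul_left_comm, mul_comm g, ← mul_assoc _ (dt f)]
  ext k
  rw [coeff_single_one_mul_dt, HahnSeries.coeff_add, coeff_mul_left' f.isPWO_support (hsupp f),
    coeff_mul_right' g.isPWO_support (hsupp g), HahnSeries.coeff_mul, Finset.mul_sum,
    ← Finset.sum_add_distrib]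
  refine Finset.sum_congr rfl fun ij hij => ?_
  rw [coeff_single_one_mul_dt, coeff_single_one_mul_dt, ← (Finset.mem_antidiagonal.mp hij).2.2]
  push_cast
  ring

lemma dt_single_one : dt (HahnSeries.single (1 : ℤ) (1 : ℂ)) = 1 := by
  ext k
  by_cases hk : k = 0
  · simp [dt_coeff, hk]
  · simp [dt_coeff, HahnSeries.coeff_one, hk, coeff_single_of_ne]

instance : CharZero (LaurentSeries ℂ) :=
  charZero_of_injective_algebraMap (algebraMap ℂ (LaurentSeries ℂ)).injective

end LaurentSeries

/-- If row `i + 1` of `g` is sent to row `i` by the connection `v ↦ v A - ∂ₜ v`, then the gauge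
transform of `A` by `g` is in oper form. -/
lemma isOperForm_gaugeGL {n : ℕ} (g : GL (Fin n) (LaurentSeries ℂ))
    (A : Matrix (Fin n) (Fin n) (LaurentSeries ℂ))
    (h : ∀ i j : Fin n, (i : ℕ) = j + 1 →
      rowConnection (fun f => -dt f) A (g.1 i) = g.1 j) : IsOperForm (gaugeGL g A) := by
  have key : ∀ i j k : Fin n, (i : ℕ) = j + 1 →
      gaugeGL g A i k = (1 : Matrix (Fin n) (Fin n) (LaurentSeries ℂ)) j k := by
    intro i j k hij
    have hrow : (g.1 * A - g.1.map dt) i = g.1 j := by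
      rw [← h i j hij]
      ext1 l
      exact sub_eq_add_neg ((g.1 * A) i l) (dt (g.1 i l))
    rw [gaugeGL, ← Matrix.sub_mul, Matrix.mul_apply_eq_vecMul, hrow, ← Matrix.mul_apply_eq_vecMul,
      ← Units.val_mul, mul_inv_cancel, Units.val_one]
  refine ⟨fun i k hik => ?_, fun i k hik => ?_⟩
  · rw [key i ⟨i - 1, by omega⟩ k (by simp only []; omega), Matrix.one_apply_ne]
    intro h
    have := congrArg Fin.val h
    simp only [] at this
    omega
  · rw [key i k k hik, Matrix.one_apply_eq]
    exact one_ne_zero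

/-- Any flat `GLₙ`-bundle on the punctured disc admits an oper structure: for every
`A ∈ Mₙ(ℂ((t)))` there is `g ∈ GLₙ(ℂ((t)))` such that `Ga_g(A) = g A g⁻¹ - (∂ₜ g) g⁻¹`
is in oper form. -/
theorem flat_bundle_has_oper_structure_GLn (n : ℕ) (hn : 1 ≤ n)
    (A : Matrix (Fin n) (Fin n) (LaurentSeries ℂ)) :
    ∃ g : GL (Fin n) (LaurentSeries ℂ), IsOperForm (gaugeGL g A) := by
  obtain ⟨v, hv⟩ := exists_cyclic_vector (-AddMonoidHom.mk' dt dt_add)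
    (fun a b => by
      change -dt (a * b) = a * -dt b + b * -dt a
      rw [dt_mul]
      ring)
    (x := -HahnSeries.single (1 : ℤ) (1 : ℂ)) (by
      rw [map_neg]
      change - -dt (HahnSeries.single (1 : ℤ) (1 : ℂ)) = 1
      rw [neg_neg, dt_single_one]) A
  obtain ⟨g, hg⟩ := (Matrix.isUnit_submatrix_equiv Fin.revPerm (Equiv.refl _)).mpr hv
  refine ⟨g, isOperForm_gaugeGL g A fun i j hij => ?_⟩
  rw [hg]
  change rowConnection (fun f => -dt f) A ((rowConnection (fun f => -dt f) A)^[Fin.rev i] v) =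
    (rowConnection (fun f => -dt f) A)^[Fin.rev j] v
  rw [← Function.iterate_succ_apply' (rowConnection (fun f => -dt f) A)]
  congr 2
  simp only [Fin.val_rev]
  omega
end
end

section
/- Let V be an n-dimensional vector space over F = ℂ((t)) and let ∇ be a connection on V. Then V admits a cyclic vector: there exists φ ∈ V such that φ, ∇φ, ∇²φ, …, ∇ⁿ⁻¹φ form a basis of V over F. (This is the main theorem for G = GLₙ, reformulated: a flat rank-n bundle on the punctured disc has an oper structure if and only if it has a cyclic vector.) -/
open HahnSeries Matrix

noncomputable section

section CyclicVector

variable {F V : Type*} [Field F] [AddCommGroup V] [Module F V]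

theorem map_pow_smul_of_map_smul (D : V →+ V) (x : F) (hx : ∀ v, D (x • v) = v + x • D v)
    (j : ℕ) (v : V) : D (x ^ (j + 1) • v) = ((j + 1 : ℕ) * x ^ j) • v + x ^ (j + 1) • D v := by
  induction j with
  | zero => simp [hx]
  | succ j ih =>
    rw [pow_succ' x (j + 1), mul_smul, hx, ih]
    push_cast
    module

theorem map_divided_pow_smul_of_map_smul [CharZero F] (D : V →+ V) (x : F)
    (hx : ∀ v, D (x • v) = v + x • D v) (j : ℕ) (v : V) :
    D (((j + 1).factorial : F)⁻¹ • x ^ (j + 1) • v) =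
      (j.factorial : F)⁻¹ • x ^ j • v + ((j + 1).factorial : F)⁻¹ • x ^ (j + 1) • D v := by
  have hj : ((j + 1 : ℕ) : F) ≠ 0 := Nat.cast_ne_zero.mpr j.succ_ne_zero
  have hf : (j.factorial : F) ≠ 0 := Nat.cast_ne_zero.mpr j.factorial_ne_zero
  rw [map_inv_natCast_smul D F F, map_pow_smul_of_map_smul D x hx, smul_add, smul_smul,
    smul_smul _ (x ^ j), Nat.factorial_succ]
  congr 2
  push_cast at hj ⊢
  field_simp

/-- The solution of `w (i + 1) j = D (w i j) + w i (j + 1)` with boundary values `w i 0 = e i`. -/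
def katzFromColumn (D : V →+ V) (e : ℕ → V) : ℕ → ℕ → V
  | i, 0 => e i
  | i, j + 1 => katzFromColumn D e (i + 1) j - D (katzFromColumn D e i j)

/-- The solution of `w (i + 1) j = D (w i j) + w i (j + 1)` whose row `w 0` is that of
`katzFromColumn`, cut off at `n`. -/
def katzCoeff (D : V →+ V) (e : ℕ → V) (n : ℕ) : ℕ → ℕ → V
  | 0, j => if j < n then katzFromColumn D e 0 j else 0
  | i + 1, j => D (katzCoeff D e n i j) + katzCoeff D e n i (j + 1)

theorem katzCoeff_eq_zero (D : V →+ V) (e : ℕ → V) {n : ℕ} (i : ℕ) {j : ℕ} (hj : n ≤ j) :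
    katzCoeff D e n i j = 0 := by
  induction i generalizing j with
  | zero => simp [katzCoeff, hj]
  | succ i ih => simp [katzCoeff, ih hj, ih (hj.trans j.le_succ)]

theorem katzCoeff_eq_katzFromColumn (D : V →+ V) (e : ℕ → V) {n i j : ℕ} (h : i + j < n) :
    katzCoeff D e n i j = katzFromColumn D e i j := by
  induction i generalizing j with
  | zero => simp [katzCoeff, show j < n by omega]
  | succ i ih =>
    rw [katzCoeff, ih (by omega), ih (by omega), katzFromColumn]
    abel

theorem iterate_katz_sum [CharZero F] (D : V →+ V) (e : ℕ → V) (m : ℕ) (x : F)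
    (hx : ∀ v, D (x • v) = v + x • D v) (i : ℕ) :
    D^[i] (∑ j ∈ Finset.range (m + 1),
        (j.factorial : F)⁻¹ • x ^ j • katzCoeff D e (m + 1) 0 j) =
      ∑ j ∈ Finset.range (m + 1), (j.factorial : F)⁻¹ • x ^ j • katzCoeff D e (m + 1) i j := by
  induction i with
  | zero => rfl
  | succ i ih =>
    rw [Function.iterate_succ_apply', ih, map_sum, Finset.sum_range_succ']
    simp only [map_divided_pow_smul_of_map_smul D x hx, katzCoeff, smul_add,
      Finset.sum_add_distrib]
    rw [Finset.sum_range_succ' (fun j => _ • _ • D _),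
      Finset.sum_range_succ (fun j => _ • _ • katzCoeff D e (m + 1) i (j + 1)),
      katzCoeff_eq_zero D e i le_rfl]
    simp
    abel

open Polynomial in
/-- **Katz's cyclic vector theorem**: an additive endomorphism `D` satisfying
`D (x • v) = v + x • D v` for infinitely many scalars `x` has a cyclic vector. -/
theorem exists_cyclic_vector_of_infinite [CharZero F] {n : ℕ} (b : Module.Basis (Fin n) F V)
    (D : V →+ V) (hD : {x : F | ∀ v, D (x • v) = v + x • D v}.Infinite) :
    ∃ φ : V, LinearIndependent F (fun i : Fin n => D^[i] φ) ∧
      Submodule.span F (Set.range fun i : Fin n => D^[i] φ) = ⊤ := by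
  classical
  obtain _ | m := n
  · exact ⟨0, linearIndependent_empty_type, have := b.repr.toEquiv.subsingleton
      Subsingleton.elim _ _⟩
  let e : ℕ → V := fun i => if h : i < m + 1 then b ⟨i, h⟩ else 0
  let w : F → ℕ → V := fun x i =>
    ∑ j ∈ Finset.range (m + 1), (j.factorial : F)⁻¹ • x ^ j • katzCoeff D e (m + 1) i j
  let M : Matrix (Fin (m + 1)) (Fin (m + 1)) F[X] := Matrix.of fun k i =>
    ∑ j ∈ Finset.range (m + 1),
      C ((j.factorial : F)⁻¹ * b.repr (katzCoeff D e (m + 1) i j) k) * X ^ j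
  have eval_det (x : F) : M.det.eval x = b.det fun i => w x i := by
    rw [← coe_evalRingHom, RingHom.map_det, Module.Basis.det_apply]
    congr 1
    ext k i
    simp only [M, w, Module.Basis.toMatrix_apply, RingHom.mapMatrix_apply, Matrix.map_apply,
      Matrix.of_apply, coe_evalRingHom, eval_finsetSum, eval_mul, eval_C, eval_pow, eval_X,
      map_sum, map_smul, Finsupp.coe_finsetSum, Finset.sum_apply, Finsupp.smul_apply, smul_eq_mul]
    exact Finset.sum_congr rfl fun j _ => by ring
  have w_zero : (fun i : Fin (m + 1) => w 0 i) = b := by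
    ext i
    have hi : katzCoeff D e (m + 1) i 0 = b i := by
      rw [katzCoeff_eq_katzFromColumn D e i.isLt, katzFromColumn]
      exact dif_pos i.isLt
    simp [w, Finset.sum_range_succ', hi]
  have det_ne_zero : M.det ≠ 0 := by
    intro h
    have := eval_det 0
    rw [w_zero, b.det_self, h] at this
    simp at this
  obtain ⟨x, hx, hroot⟩ := hD.exists_notMem_finset M.det.roots.toFinset
  rw [Multiset.mem_toFinset, mem_roots det_ne_zero, IsRoot.def, eval_det] at hroot
  refine ⟨w x 0, ?_⟩
  rw [Module.Basis.is_basis_iff_det b]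
  simp only [w, iterate_katz_sum D e m x hx]
  exact isUnit_iff_ne_zero.mpr hroot

end CyclicVector

theorem dt_single_sub_C (a : ℂ) : dt (single 1 1 - HahnSeries.C a) = 1 := by
  ext k
  rcases eq_or_ne k 0 with rfl | hk
  · simp [dt]
  · rcases eq_or_ne (k + 1) 0 with h | h
    · simp [dt, hk, show (k : ℂ) + 1 = 0 by exact_mod_cast h]
    · simp [dt, hk, h, HahnSeries.coeff_one]

/-- Any connection on an `n`-dimensional vector space over `ℂ((t))` admits a cyclic vector:
there is `φ` such that `φ, ∇φ, …, ∇ⁿ⁻¹φ` form a basis over `ℂ((t))`. -/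
theorem connection_has_cyclic_vector (n : ℕ) (hn : 1 ≤ n)
    (V : Type) [AddCommGroup V] [Module ℂ V] [Module (LaurentSeries ℂ) V]
    [IsScalarTower ℂ (LaurentSeries ℂ) V] [FiniteDimensional (LaurentSeries ℂ) V]
    (hdim : Module.finrank (LaurentSeries ℂ) V = n)
    (nabla : V →ₗ[ℂ] V)
    (hleib : ∀ (f : LaurentSeries ℂ) (v : V), nabla (f • v) = dt f • v + f • nabla v) :
    ∃ φ : V, LinearIndependent (LaurentSeries ℂ) (fun i : Fin n => (⇑nabla)^[(i : ℕ)] φ) ∧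
      Submodule.span (LaurentSeries ℂ) (Set.range fun i : Fin n => (⇑nabla)^[(i : ℕ)] φ) = ⊤ := by
  have : CharZero (LaurentSeries ℂ) :=
    charZero_of_injective_algebraMap (algebraMap ℂ (LaurentSeries ℂ)).injective
  have b := (Module.finBasis (LaurentSeries ℂ) V).reindex (finCongr hdim)
  refine exists_cyclic_vector_of_infinite b nabla.toAddMonoidHom
    ((Set.infinite_range_of_injective (f := fun a : ℂ => (single 1 1 - HahnSeries.C a :
      LaurentSeries ℂ)) fun a a' h => HahnSeries.C_injective (sub_right_injective h)).mono ?_)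
  rintro _ ⟨a, rfl⟩ v
  change nabla _ = _ + _ • nabla v
  rw [hleib, dt_single_sub_C, one_smul]
end
end

section
/- Let n ≥ 2, let r ≤ −2 be an integer, and let A ∈ Mₙ(F) with A ∈ tʳ Mₙ(O) whose coefficient of tʳ equals the regular nilpotent matrix f = Σ_{i=1}^{n−1} E_{i+1,i} (the lower Jordan block). Let e = Σ_{i=1}^{n−1} i(n−i) E_{i,i+1}, so that {e, 2ρ̌, f} is a principal sl₂-triple in Mₙ(ℂ). Then there exists g ∈ GLₙ(O) with g ≡ 1 (mod t) such that Ga_g(A) − f·tʳ lies in 𝔤ᵉ(F), where 𝔤ᵉ = {Z ∈ Mₙ(ℂ) : eZ = Ze} is the centralizer of e; in particular Ga_g(A) is in oper form. -/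
open HahnSeries Matrix

noncomputable section

/-- The regular nilpotent lower Jordan block `f = Σ_{i=1}^{n-1} E_{i+1,i}`. -/
def fmat (n : ℕ) : Matrix (Fin n) (Fin n) ℂ :=
  Matrix.of fun i j => if (i : ℕ) = (j : ℕ) + 1 then 1 else 0

/-- The matrix `e = Σ_{i=1}^{n-1} i(n-i) E_{i,i+1}`, completing `f` to a principal
`sl₂`-triple `{e, 2ρ̌, f}`. -/
def emat (n : ℕ) : Matrix (Fin n) (Fin n) ℂ :=
  Matrix.of fun i j =>
    if (j : ℕ) = (i : ℕ) + 1 then ((((i : ℕ) + 1) * (n - ((i : ℕ) + 1)) : ℕ) : ℂ) else 0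

/-- A recursion whose step `F k` only looks at the terms of index at most `k` has a solution. -/
theorem exists_seq_of_step {α : Type*} (a : α) (F : ℕ → (ℕ → α) → α)
    (hF : ∀ k s s', (∀ i ≤ k, s i = s' i) → F k s = F k s') :
    ∃ s : ℕ → α, s 0 = a ∧ ∀ k, s (k + 1) = F k s := by
  let T : ℕ → ℕ → α := fun k => Nat.rec (fun _ => a)
    (fun k t => Function.update t (k + 1) (F k t)) k
  have hT : ∀ k, T (k + 1) = Function.update (T k) (k + 1) (F k (T k)) := fun _ => rfl
  have stable : ∀ i j, i ≤ j → T j i = T i i := by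
    intro i j hij
    induction j, hij using Nat.le_induction with
    | base => rfl
    | succ j hij ih => rw [hT, Function.update_of_ne (by omega), ih]
  refine ⟨fun k => T k k, rfl, fun k => ?_⟩
  simp only [hT, Function.update_self]
  exact hF _ _ _ fun i hi => stable i k hi

/-- The diagonal weights conjugating the transpose of `f` to `e`. -/
def sl2Weight (n i : ℕ) : ℝ :=
  ∏ k ∈ Finset.range i, (((k + 1) * (n - (k + 1)) : ℕ) : ℝ)

theorem sl2Weight_pos {n i : ℕ} (hi : i < n) : 0 < sl2Weight n i := by
  refine Finset.prod_pos fun k hk => ?_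
  have hk := Finset.mem_range.mp hk
  exact_mod_cast Nat.mul_pos (Nat.succ_pos k) (by omega)

/-- The weights `sl2Weight` as a diagonal matrix. -/
def sl2Diag (n : ℕ) : Matrix (Fin n) (Fin n) ℂ :=
  Matrix.diagonal fun i => (sl2Weight n i : ℂ)

theorem sl2Diag_mul_emat (n : ℕ) : sl2Diag n * emat n = (fmat n)ᴴ * sl2Diag n := by
  ext i j
  rw [sl2Diag, Matrix.diagonal_mul, Matrix.mul_diagonal]
  by_cases h : (j : ℕ) = i + 1
  · simp [emat, fmat, h, sl2Weight, Finset.prod_range_succ]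
  · simp [emat, fmat, h]

theorem isUnit_det_sl2Diag (n : ℕ) : IsUnit (sl2Diag n).det := by
  rw [sl2Diag, Matrix.det_diagonal, isUnit_iff_ne_zero]
  exact Finset.prod_ne_zero_iff.mpr fun i _ => by
    exact_mod_cast (sl2Weight_pos i.2).ne'

/-- A matrix commuting with `f` and trace-orthogonal to the centralizer of `e` is zero. -/
theorem eq_zero_of_commute_fmat_of_trace {n : ℕ} (X : Matrix (Fin n) (Fin n) ℂ)
    (hX : X * fmat n = fmat n * X)
    (h : ∀ Z, emat n * Z = Z * emat n → (X * Z).trace = 0) : X = 0 := by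
  have hD := isUnit_det_sl2Diag n
  have he : emat n = (sl2Diag n)⁻¹ * (fmat n)ᴴ * sl2Diag n := by
    rw [Matrix.mul_assoc, ← sl2Diag_mul_emat, Matrix.nonsing_inv_mul_cancel_left _ _ hD]
  have hcomm : emat n * ((sl2Diag n)⁻¹ * Xᴴ * sl2Diag n) =
      (sl2Diag n)⁻¹ * Xᴴ * sl2Diag n * emat n := by
    have hX' := congrArg Matrix.conjTranspose hX
    rw [Matrix.conjTranspose_mul, Matrix.conjTranspose_mul] at hX'
    rw [he]
    simp only [Matrix.mul_assoc, Matrix.mul_nonsing_inv_cancel_left _ _ hD]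
    rw [← Matrix.mul_assoc (fmat n)ᴴ, hX', Matrix.mul_assoc]
  have htr := h _ hcomm
  have hinv : (sl2Diag n)⁻¹ = Matrix.diagonal fun i : Fin n => ((sl2Weight n i : ℂ))⁻¹ := by
    refine Matrix.inv_eq_left_inv ?_
    rw [sl2Diag, Matrix.diagonal_mul_diagonal, ← Matrix.diagonal_one]
    congr 1
    ext i
    exact inv_mul_cancel₀ (by exact_mod_cast (sl2Weight_pos i.2).ne')
  have hsum : ∑ i : Fin n, ∑ j : Fin n,
      Complex.normSq (X i j) * ((sl2Weight n j)⁻¹ * sl2Weight n i) = 0 := by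
    rw [hinv] at htr
    simp only [Matrix.trace, Matrix.diag_apply, Matrix.mul_apply (M := X), sl2Diag,
      Matrix.mul_diagonal, Matrix.diagonal_mul, Matrix.conjTranspose_apply,
      Complex.star_def] at htr
    have : ((∑ i : Fin n, ∑ j : Fin n,
      Complex.normSq (X i j) * ((sl2Weight n j)⁻¹ * sl2Weight n i) : ℝ) : ℂ) = 0 := by
      rw [← htr]
      push_cast
      refine Finset.sum_congr rfl fun i _ => Finset.sum_congr rfl fun j _ => ?_
      rw [Complex.normSq_eq_conj_mul_self]
      ring
    exact_mod_cast this
  have hpos : ∀ i j : Fin n, 0 < (sl2Weight n j)⁻¹ * sl2Weight n i := fun i j =>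
    mul_pos (inv_pos.mpr (sl2Weight_pos j.2)) (sl2Weight_pos i.2)
  have hnn : ∀ i j : Fin n,
      0 ≤ Complex.normSq (X i j) * ((sl2Weight n j)⁻¹ * sl2Weight n i) := fun i j =>
    mul_nonneg (Complex.normSq_nonneg _) (hpos i j).le
  ext i j
  have h1 := (Finset.sum_eq_zero_iff_of_nonneg fun i _ =>
    Finset.sum_nonneg fun j _ => hnn i j).mp hsum i (Finset.mem_univ i)
  have h2 := (Finset.sum_eq_zero_iff_of_nonneg fun j _ => hnn i j).mp h1 j (Finset.mem_univ j)
  exact Complex.normSq_eq_zero.mp ((mul_eq_zero.mp h2).resolve_right (hpos i j).ne')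

/-- The centralizer of `e` as a subspace of `Mₙ(ℂ)`. -/
def centE (n : ℕ) : Submodule ℂ (Matrix (Fin n) (Fin n) ℂ) :=
  LinearMap.ker (LinearMap.mulLeft ℂ (emat n) - LinearMap.mulRight ℂ (emat n))

theorem mem_centE {n : ℕ} {Z : Matrix (Fin n) (Fin n) ℂ} :
    Z ∈ centE n ↔ emat n * Z = Z * emat n := by
  simp [centE, sub_eq_zero]

/-- `Mₙ(ℂ) = im (ad f) + ker (ad e)`. -/
theorem exists_sub_add_centE {n : ℕ} (X : Matrix (Fin n) (Fin n) ℂ) :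
    ∃ Y Z : Matrix (Fin n) (Fin n) ℂ, Z ∈ centE n ∧ fmat n * Y - Y * fmat n + Z = X := by
  let S := LinearMap.mulLeft ℂ (fmat n) - LinearMap.mulRight ℂ (fmat n)
  suffices h : LinearMap.range S ⊔ centE n = ⊤ by
    obtain ⟨_, ⟨Y, rfl⟩, Z, hZ, hXYZ⟩ := Submodule.mem_sup.mp (h ▸ Submodule.mem_top (x := X))
    exact ⟨Y, Z, hZ, by simpa [S] using hXYZ⟩
  by_contra hne
  obtain ⟨φ, hφ, hker⟩ := Submodule.exists_le_ker_of_lt_top _ (lt_top_iff_ne_top.mpr hne)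
  let W : Matrix (Fin n) (Fin n) ℂ := Matrix.of fun i j => φ (Matrix.single j i 1)
  have hW : ∀ Y, φ Y = (W * Y).trace := by
    intro Y
    conv_lhs => rw [Matrix.matrix_eq_sum_single Y]
    simp only [map_sum, Matrix.trace, Matrix.diag_apply, Matrix.mul_apply, W, Matrix.of_apply]
    rw [Finset.sum_comm]
    refine Finset.sum_congr rfl fun j _ => Finset.sum_congr rfl fun i _ => ?_
    rw [← mul_one (Y i j), ← smul_eq_mul, ← Matrix.smul_single, map_smul]
    simp [mul_comm]
  have hW0 : W = 0 := by
    refine eq_zero_of_commute_fmat_of_trace W ?_ ?_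
    · refine Matrix.ext_iff_trace_mul_right.mpr fun Y => ?_
      have h := hker (Submodule.mem_sup_left (LinearMap.mem_range_self S Y))
      rw [LinearMap.mem_ker, hW] at h
      simp only [S, LinearMap.sub_apply, LinearMap.mulLeft_apply, LinearMap.mulRight_apply,
        Matrix.mul_sub, Matrix.trace_sub, sub_eq_zero] at h
      rw [Matrix.mul_assoc, h, ← Matrix.mul_assoc, Matrix.trace_mul_comm, Matrix.mul_assoc]
    · intro Z hZ
      rw [← hW]
      exact hker (Submodule.mem_sup_right (mem_centE.mpr hZ))
  exact hφ (LinearMap.ext fun Y => by simp [hW, hW0])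

/-- The centralizer of `e` consists of upper triangular matrices. -/
theorem centE_upper {n : ℕ} {Z : Matrix (Fin n) (Fin n) ℂ} (hZ : Z ∈ centE n) :
    ∀ (j i : ℕ) (hj : j < n) (hi : i < n), j < i → Z ⟨i, hi⟩ ⟨j, hj⟩ = 0 := by
  rw [mem_centE] at hZ
  have key : ∀ (i : ℕ) (hi : i + 1 < n) (j : Fin n), (emat n * Z) ⟨i, by omega⟩ j =
      (((i + 1) * (n - (i + 1)) : ℕ) : ℂ) * Z ⟨i + 1, hi⟩ j := by
    intro i hi j
    rw [Matrix.mul_apply, Finset.sum_eq_single ⟨i + 1, hi⟩]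
    · rw [emat, Matrix.of_apply, if_pos rfl]
    · intro b _ hb
      have : (b : ℕ) ≠ i + 1 := fun h => hb (Fin.ext h)
      simp [emat, this]
    · simp
  have eq_zero_of_mul_emat : ∀ (i : ℕ) (hi : i + 1 < n) (j : Fin n),
      (Z * emat n) ⟨i, by omega⟩ j = 0 →
      Z ⟨i + 1, hi⟩ j = 0 := by
    intro i hi j h
    rw [← hZ, key i hi] at h
    refine (mul_eq_zero.mp h).resolve_left ?_
    exact_mod_cast (Nat.mul_pos (Nat.succ_pos i) (by omega)).ne'
  intro j
  induction j with
  | zero =>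
    intro i hj hi hij
    obtain ⟨i, rfl⟩ := Nat.exists_eq_succ_of_ne_zero hij.ne'
    refine eq_zero_of_mul_emat i hi _ ?_
    simp [Matrix.mul_apply, emat]
  | succ j ih =>
    intro i hj hi hij
    obtain ⟨i, rfl⟩ := Nat.exists_eq_succ_of_ne_zero (by omega : i ≠ 0)
    refine eq_zero_of_mul_emat i hi _ ?_
    rw [Matrix.mul_apply]
    refine Finset.sum_eq_zero fun b _ => ?_
    by_cases hb : (b : ℕ) = j
    · have : Z ⟨i, by omega⟩ b = 0 := by
        have := ih i (by omega) (by omega) (by omega)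
        rwa [show b = ⟨j, by omega⟩ from Fin.ext hb]
      rw [this, zero_mul]
    · have : ¬ (j = (b : ℕ)) := fun h => hb h.symm
      simp [emat, this]

theorem algebraMap_eq_single (c : ℂ) :
    algebraMap ℂ (LaurentSeries ℂ) c = HahnSeries.single 0 c := by
  simp [HahnSeries.algebraMap_apply']

theorem coeff_mul_algebraMap (x : LaurentSeries ℂ) (c : ℂ) (k : ℤ) :
    (x * algebraMap ℂ (LaurentSeries ℂ) c).coeff k = x.coeff k * c := by
  rw [algebraMap_eq_single]
  exact HahnSeries.coeff_mul_single_zero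

/-- A matrix of Laurent series all of whose coefficient matrices lie in a subspace `W` of `Mₙ(ℂ)`
lies in the span of `W` over the Laurent series. -/
theorem mem_span_of_coeff_mem {n : ℕ} (W : Submodule ℂ (Matrix (Fin n) (Fin n) ℂ))
    (N : Matrix (Fin n) (Fin n) (LaurentSeries ℂ))
    (hN : ∀ k, N.map (fun x => x.coeff k) ∈ W) :
    N ∈ Submodule.span (LaurentSeries ℂ)
      ((fun Z : Matrix (Fin n) (Fin n) ℂ => Z.map (algebraMap ℂ (LaurentSeries ℂ))) ''
        (W : Set (Matrix (Fin n) (Fin n) ℂ))) := by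
  obtain ⟨P, hP⟩ := LinearMap.exists_leftInverse_of_injective W.subtype
    (LinearMap.ker_eq_bot.mpr W.subtype_injective)
  have hsum : N = ∑ i, ∑ j, N i j •
      ((P (Matrix.single i j 1) : Matrix (Fin n) (Fin n) ℂ).map
        (algebraMap ℂ (LaurentSeries ℂ))) := by
    ext a b k
    have h1 : ((P (N.map fun x => x.coeff k) : W) : Matrix (Fin n) (Fin n) ℂ) =
        N.map fun x => x.coeff k := by
      have := LinearMap.congr_fun hP ⟨_, hN k⟩
      exact congrArg Subtype.val this
    rw [← Matrix.map_apply (f := fun x : LaurentSeries ℂ => x.coeff k) (M := N)]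
    rw [← congrFun (congrFun h1 a) b]
    conv_lhs => rw [Matrix.matrix_eq_sum_single (N.map fun x => x.coeff k)]
    simp only [map_sum, Submodule.coe_sum, Matrix.sum_apply, Matrix.map_apply,
      Matrix.smul_apply, smul_eq_mul, HahnSeries.coeff_sum]
    refine Finset.sum_congr rfl fun i _ => Finset.sum_congr rfl fun j _ => ?_
    rw [coeff_mul_algebraMap]
    have h3 : Matrix.single i j ((N i j).coeff k) =
        (N i j).coeff k • Matrix.single i j (1 : ℂ) := by simp [Matrix.smul_single]
    rw [h3, map_smul]
    simp
  rw [hsum]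
  exact Submodule.sum_mem _ fun i _ => Submodule.sum_mem _ fun j _ =>
    Submodule.smul_mem _ _ (Submodule.subset_span ⟨_, (P _).2, rfl⟩)

theorem coeff_ofPowerSeries (f : PowerSeries ℂ) (k : ℤ) :
    (HahnSeries.ofPowerSeries ℤ ℂ f).coeff k =
      if k < 0 then 0 else PowerSeries.coeff k.natAbs f :=
  PowerSeries.coeff_coe f k

theorem dt_ofPowerSeries (f : PowerSeries ℂ) :
    dt (HahnSeries.ofPowerSeries ℤ ℂ f) =
      HahnSeries.ofPowerSeries ℤ ℂ (PowerSeries.derivative ℂ f) := by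
  ext k
  change ((k + 1 : ℤ) : ℂ) * (HahnSeries.ofPowerSeries ℤ ℂ f).coeff (k + 1) = _
  rw [coeff_ofPowerSeries, coeff_ofPowerSeries]
  rcases lt_trichotomy k (-1) with h | rfl | h
  · simp [show k + 1 < 0 by omega, show k < 0 by omega]
  · simp
  · obtain ⟨m, rfl⟩ := Int.eq_ofNat_of_zero_le (show 0 ≤ k by omega)
    rw [if_neg (by omega), if_neg (by omega), PowerSeries.coeff_derivative,
      show ((m : ℤ) + 1).natAbs = m + 1 by omega, Int.natAbs_natCast]
    push_cast
    ring

theorem exists_ofPowerSeries_of_coeff {r : ℤ} (x : LaurentSeries ℂ)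
    (hx : ∀ k < r, x.coeff k = 0) :
    x = HahnSeries.single r 1 *
      HahnSeries.ofPowerSeries ℤ ℂ (PowerSeries.mk fun m => x.coeff (r + m)) := by
  ext k
  obtain ⟨l, rfl⟩ : ∃ l, k = l + r := ⟨k - r, by ring⟩
  rw [HahnSeries.coeff_single_mul_add, coeff_ofPowerSeries]
  split_ifs with h
  · rw [hx _ (by omega), mul_zero]
  · rw [PowerSeries.coeff_mk, one_mul, Int.natAbs_of_nonneg (by omega), add_comm]

/-- The coefficient matrix of a product of matrices of power series. -/
theorem map_coeff_mul {n : ℕ} (M N : Matrix (Fin n) (Fin n) (PowerSeries ℂ)) (m : ℕ) :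
    (M * N).map (PowerSeries.coeff m) = ∑ p ∈ Finset.HasAntidiagonal.antidiagonal m,
      M.map (PowerSeries.coeff p.1) * N.map (PowerSeries.coeff p.2) := by
  ext i j
  simp only [Matrix.map_apply, Matrix.mul_apply, Matrix.sum_apply, map_sum, PowerSeries.coeff_mul]
  exact Finset.sum_comm

theorem sum_antidiagonal_succ_eq_ends_add {R : Type*} [NonUnitalNonAssocSemiring R]
    (u v : ℕ → R) (k : ℕ) :
    ∑ p ∈ Finset.HasAntidiagonal.antidiagonal (k + 1), u p.1 * v p.2 =
      u 0 * v (k + 1) + u (k + 1) * v 0 + ∑ i ∈ Finset.range k, u (i + 1) * v (k - i) := by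
  rw [Finset.Nat.sum_antidiagonal_succ,
    Finset.Nat.sum_antidiagonal_eq_sum_range_succ (fun a b => u (a + 1) * v b),
    Finset.sum_range_succ, Nat.sub_self, add_comm (∑ i ∈ Finset.range k, _), ← add_assoc]

/-- The coefficientwise solution of the gauge equation `g A - t^(p+2) ∂ₜ g = B g`. -/
theorem exists_gauge_coeffs {n : ℕ} (A : ℕ → Matrix (Fin n) (Fin n) ℂ) (hA : A 0 = fmat n)
    (p : ℕ) :
    ∃ G B : ℕ → Matrix (Fin n) (Fin n) ℂ, G 0 = 1 ∧ B 0 = fmat n ∧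
      (∀ k, B (k + 1) ∈ centE n) ∧
      ∀ k, ∑ x ∈ Finset.HasAntidiagonal.antidiagonal (k + 1), G x.1 * A x.2 - (k - p) • G (k - p) =
        ∑ x ∈ Finset.HasAntidiagonal.antidiagonal (k + 1), B x.1 * G x.2 := by
  choose Y Z hZ hYZ using exists_sub_add_centE (n := n)
  let R : ℕ → (ℕ → Matrix (Fin n) (Fin n) ℂ × Matrix (Fin n) (Fin n) ℂ) →
      Matrix (Fin n) (Fin n) ℂ := fun k s =>
    A (k + 1) + ∑ i ∈ Finset.range k, (s (i + 1)).1 * A (k - i) - (k - p) • (s (k - p)).1 -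
      ∑ i ∈ Finset.range k, (s (i + 1)).2 * (s (k - i)).1
  obtain ⟨s, hs0, hs⟩ := exists_seq_of_step
    ((1 : Matrix (Fin n) (Fin n) ℂ), fmat n) (fun k s => (Y (R k s), Z (R k s))) (by
      intro k s s' h
      have : R k s = R k s' := by
        simp only [R]
        rw [h (k - p) (by omega)]
        congr 1
        · congr 2
          refine Finset.sum_congr rfl fun i hi => ?_
          rw [h (i + 1) (Finset.mem_range.mp hi)]
        · refine Finset.sum_congr rfl fun i hi => ?_
          rw [h (i + 1) (Finset.mem_range.mp hi), h (k - i) (by omega)]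
      rw [this])
  refine ⟨fun k => (s k).1, fun k => (s k).2, by simp [hs0], by simp [hs0], fun k => ?_,
    fun k => ?_⟩
  · simp only [hs]
    exact hZ _
  · rw [sum_antidiagonal_succ_eq_ends_add (fun k => (s k).1) A,
      sum_antidiagonal_succ_eq_ends_add (fun k => (s k).2) (fun k => (s k).1)]
    have h := hYZ (R k s)
    have h1 : (s (k + 1)).1 = Y (R k s) := by rw [hs]
    have h2 : (s (k + 1)).2 = Z (R k s) := by rw [hs]
    rw [← h1, ← h2] at h
    simp only [hs0, hA, Matrix.one_mul, Matrix.mul_one]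
    simp only [R] at h
    rw [← sub_eq_zero] at h ⊢
    rw [← neg_eq_zero, ← h]
    abel

/-- The solution of the gauge equation `g A - t^(p+2) ∂ₜ g = B g` over power series. -/
theorem exists_gauge_powerSeries {n : ℕ} (A : Matrix (Fin n) (Fin n) (PowerSeries ℂ))
    (hA : A.map (PowerSeries.coeff 0) = fmat n) (p : ℕ) :
    ∃ G B : Matrix (Fin n) (Fin n) (PowerSeries ℂ),
      G.map (PowerSeries.coeff 0) = 1 ∧ B.map (PowerSeries.coeff 0) = fmat n ∧
      (∀ k, B.map (PowerSeries.coeff (k + 1)) ∈ centE n) ∧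
      G * A - (PowerSeries.X ^ (p + 2) : PowerSeries ℂ) • G.map (PowerSeries.derivative ℂ) =
        B * G := by
  obtain ⟨G, B, hG0, hB0, hB, h⟩ :=
    exists_gauge_coeffs (fun k => A.map (PowerSeries.coeff k)) hA p
  let toPS : (ℕ → Matrix (Fin n) (Fin n) ℂ) → Matrix (Fin n) (Fin n) (PowerSeries ℂ) :=
    fun M => Matrix.of fun i j => PowerSeries.mk fun k => M k i j
  have hc : ∀ M k, (toPS M).map (PowerSeries.coeff k) = M k := by
    intro M k
    ext i j
    simp [toPS]
  refine ⟨toPS G, toPS B, by rw [hc, hG0], by rw [hc, hB0], fun k => by rw [hc]; exact hB k, ?_⟩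
  have hcoeff : ∀ m, (toPS G * A).map (PowerSeries.coeff m) -
      ((PowerSeries.X ^ (p + 2) : PowerSeries ℂ) •
        (toPS G).map (PowerSeries.derivative ℂ)).map (PowerSeries.coeff m) =
      (toPS B * toPS G).map (PowerSeries.coeff m) := by
    intro m
    rw [map_coeff_mul, map_coeff_mul]
    simp only [hc]
    cases m with
    | zero =>
      have h0 : ((PowerSeries.X ^ (p + 2) : PowerSeries ℂ) •
          (toPS G).map (PowerSeries.derivative ℂ)).map (PowerSeries.coeff 0) = 0 := by
        ext i j
        simp
      simp only [h0, Finset.Nat.antidiagonal_zero, Finset.sum_singleton, hG0, hB0, hA,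
        Matrix.one_mul, Matrix.mul_one, sub_zero]
    | succ k =>
      rw [← h k]
      congr 1
      ext i j
      simp only [Matrix.map_apply, Matrix.smul_apply, smul_eq_mul, PowerSeries.coeff_X_pow_mul',
        PowerSeries.coeff_derivative, nsmul_eq_mul, toPS, Matrix.of_apply,
        PowerSeries.coeff_mk]
      split_ifs with hle
      · rw [show k + 1 - (p + 2) + 1 = k - p by omega]
        rw [mul_comm]
        congr 1
        rw [show k - p = k + 1 - (p + 2) + 1 by omega]
        push_cast
        rfl
      · rw [show k - p = 0 by omega]
        simp
  ext i j m
  simpa using congrFun (congrFun (hcoeff m) i) j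

/-- Transport of the gauge equation along a ring homomorphism, up to a scalar factor. -/
theorem map_gauge_equation {R K : Type*} [CommRing R] [CommRing K] (ι : R →+* K) (s : K) {n : ℕ}
    {G A' D B : Matrix (Fin n) (Fin n) R} (h : G * A' - D = B * G)
    {A dG : Matrix (Fin n) (Fin n) K} (hA : ∀ i j, A i j = s * ι (A' i j))
    (hdG : ∀ i j, dG i j = s * ι (D i j)) :
    G.map ι * A - dG = (Matrix.of fun i j => s * ι (B i j)) * G.map ι := by
  have hA' : A = s • A'.map ι := by ext i j; exact hA i j
  have hdG' : dG = s • D.map ι := by ext i j; exact hdG i j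
  have hB : (Matrix.of fun i j => s * ι (B i j)) = s • B.map ι := rfl
  rw [hA', hdG', hB, Matrix.mul_smul, Matrix.smul_mul, ← smul_sub, ← Matrix.map_mul,
    ← Matrix.map_mul, ← h, Matrix.map_sub ι (map_sub ι)]

/-- If `A ∈ tʳ Mₙ(O)` with `r ≤ -2` has leading coefficient the regular nilpotent `f`,
then there is `g ∈ GLₙ(O)` with `g ≡ 1 (mod t)` such that `Ga_g(A) - f tʳ` lies in the
`F`-span `𝔤ᵉ(F)` of the centralizer of `e`; in particular `Ga_g(A)` is in oper form. -/
theorem gauge_to_oper_of_regular_nilpotent_leading_term (n : ℕ) (hn : 2 ≤ n)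
    (r : ℤ) (hr : r ≤ -2)
    (A : Matrix (Fin n) (Fin n) (LaurentSeries ℂ))
    (hAO : ∀ i j : Fin n, ∀ k : ℤ, k < r → (A i j).coeff k = 0)
    (hAr : ∀ i j : Fin n, (A i j).coeff r = fmat n i j) :
    ∃ g : GL (Fin n) (LaurentSeries ℂ),
      (∀ i j : Fin n, ∀ k : ℤ, k < 0 →
        ((g : Matrix (Fin n) (Fin n) (LaurentSeries ℂ)) i j).coeff k = 0) ∧
      (∀ i j : Fin n,
        ((g : Matrix (Fin n) (Fin n) (LaurentSeries ℂ)) i j).coeff 0 =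
          (1 : Matrix (Fin n) (Fin n) ℂ) i j) ∧
      gaugeGL g A - (HahnSeries.single r (1 : ℂ)) • (fmat n).map (algebraMap ℂ (LaurentSeries ℂ)) ∈
        Submodule.span (LaurentSeries ℂ)
          ((fun Z : Matrix (Fin n) (Fin n) ℂ => Z.map (algebraMap ℂ (LaurentSeries ℂ))) ''
            {Z | emat n * Z = Z * emat n}) ∧
      IsOperForm (gaugeGL g A) := by
  obtain ⟨p, rfl⟩ : ∃ p : ℕ, r = -((p + 2 : ℕ) : ℤ) := ⟨(-r - 2).toNat, by omega⟩
  set r : ℤ := -((p + 2 : ℕ) : ℤ) with hrdef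
  let ι := HahnSeries.ofPowerSeries ℤ ℂ
  let A' : Matrix (Fin n) (Fin n) (PowerSeries ℂ) :=
    Matrix.of fun i j => PowerSeries.mk fun m => (A i j).coeff (r + m)
  have hA' : ∀ i j, A i j = HahnSeries.single r (1 : ℂ) * ι (A' i j) := fun i j =>
    exists_ofPowerSeries_of_coeff (A i j) (hAO i j)
  obtain ⟨G, B, hG0, hB0, hB, hGB⟩ := exists_gauge_powerSeries A' (by
    ext i j
    simp [A', hAr]) p
  have hdet : IsUnit G.det := by
    rw [PowerSeries.isUnit_iff_constantCoeff, RingHom.map_det]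
    have : (PowerSeries.constantCoeff (R := ℂ)).mapMatrix G = 1 := by
      rw [← hG0]
      ext i j
      simp
    rw [this, Matrix.det_one]
    exact isUnit_one
  let g' : GL (Fin n) (PowerSeries ℂ) := Matrix.GeneralLinearGroup.mk'' G hdet
  let g : GL (Fin n) (LaurentSeries ℂ) := Matrix.GeneralLinearGroup.map ι g'
  have hg : (g : Matrix (Fin n) (Fin n) (LaurentSeries ℂ)) = G.map ι := rfl
  have hdt : ∀ i j, (G.map ι).map dt i j = HahnSeries.single r (1 : ℂ) *
      ι (((PowerSeries.X ^ (p + 2) : PowerSeries ℂ) • G.map (PowerSeries.derivative ℂ)) i j) := by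
    intro i j
    simp only [Matrix.map_apply, Matrix.smul_apply, smul_eq_mul, map_mul, ι, dt_ofPowerSeries,
      HahnSeries.ofPowerSeries_X_pow]
    rw [← mul_assoc, HahnSeries.single_mul_single, hrdef, neg_add_cancel, one_mul]
    exact (one_mul _).symm
  have hgauge : gaugeGL g A =
      Matrix.of fun i j => (HahnSeries.single r (1 : ℂ) : LaurentSeries ℂ) * ι (B i j) := by
    have hBG := map_gauge_equation (K := LaurentSeries ℂ) ι (HahnSeries.single r 1) hGB hA' hdt
    rw [gaugeGL, ← Matrix.sub_mul, hg, hBG, ← hg, Matrix.mul_assoc, ← Units.val_mul,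
      mul_inv_cancel, Units.val_one, Matrix.mul_one]
  have hspan : gaugeGL g A -
      (HahnSeries.single r (1 : ℂ)) • (fmat n).map (algebraMap ℂ (LaurentSeries ℂ)) ∈
        Submodule.span (LaurentSeries ℂ)
          ((fun Z : Matrix (Fin n) (Fin n) ℂ => Z.map (algebraMap ℂ (LaurentSeries ℂ))) ''
            (centE n : Set (Matrix (Fin n) (Fin n) ℂ))) := by
    refine mem_span_of_coeff_mem _ _ fun k => ?_
    obtain ⟨k, rfl⟩ : ∃ l, k = l + r := ⟨k - r, by ring⟩
    have hentry : ∀ i j, ((gaugeGL g A - (HahnSeries.single r (1 : ℂ)) •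
        (fmat n).map (algebraMap ℂ (LaurentSeries ℂ))) i j).coeff (k + r) =
        (if k < 0 then 0 else PowerSeries.coeff k.natAbs (B i j)) -
          if k = 0 then fmat n i j else 0 := by
      intro i j
      rw [hgauge]
      change ((HahnSeries.single r (1 : ℂ) : LaurentSeries ℂ) * ι (B i j)).coeff (k + r) -
        ((HahnSeries.single r (1 : ℂ) : LaurentSeries ℂ) *
          algebraMap ℂ (LaurentSeries ℂ) (fmat n i j)).coeff (k + r) = _
      rw [HahnSeries.coeff_single_mul_add, HahnSeries.coeff_single_mul_add, one_mul, one_mul,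
        coeff_ofPowerSeries, algebraMap_eq_single, HahnSeries.coeff_single]
      congr
    rcases lt_trichotomy k 0 with hk | rfl | hk
    · convert (centE n).zero_mem
      ext i j
      rw [Matrix.map_apply, hentry]
      simp [hk, hk.ne]
    · convert (centE n).zero_mem
      ext i j
      rw [Matrix.map_apply, hentry, ← hB0]
      simp
    · obtain ⟨m, rfl⟩ : ∃ m : ℕ, k = (m + 1 : ℕ) := ⟨(k - 1).toNat, by omega⟩
      convert hB m
      ext i j
      rw [Matrix.map_apply, hentry, if_neg (by omega), if_neg (by omega), sub_zero]
      rfl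
  have hupper : ∀ N ∈ Submodule.span (LaurentSeries ℂ)
      ((fun Z : Matrix (Fin n) (Fin n) ℂ => Z.map (algebraMap ℂ (LaurentSeries ℂ))) ''
        (centE n : Set (Matrix (Fin n) (Fin n) ℂ))), ∀ i j : Fin n, j < i → N i j = 0 := by
    intro N hN i j hij
    induction hN using Submodule.span_induction with
    | mem x hx =>
      obtain ⟨Z, hZ, rfl⟩ := hx
      simp only [Matrix.map_apply]
      rw [centE_upper hZ j i j.2 i.2 hij, map_zero]
    | zero => rfl
    | add x y _ _ hx hy => rw [Matrix.add_apply, hx, hy, add_zero]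
    | smul a x _ hx => rw [Matrix.smul_apply, smul_eq_mul, hx, mul_zero]
  have hlower : ∀ i j : Fin n, j < i →
      gaugeGL g A i j = HahnSeries.single r (1 : ℂ) *
        algebraMap ℂ (LaurentSeries ℂ) (fmat n i j) := fun i j hij =>
    sub_eq_zero.mp (hupper _ hspan i j hij)
  refine ⟨g, fun i j k hk => ?_, fun i j => ?_, ?_, fun i j hij => ?_, fun i j hij => ?_⟩
  · rw [hg, Matrix.map_apply, coeff_ofPowerSeries, if_pos hk]
  · rw [hg, Matrix.map_apply, coeff_ofPowerSeries, if_neg (by omega), ← hG0]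
    rfl
  · convert hspan using 3
    ext Z
    exact mem_centE.symm
  · rw [hlower i j (Fin.lt_def.mpr (by omega))]
    simp [fmat, show ¬ ((i : ℕ) = j + 1) by omega]
  · rw [hlower i j (Fin.lt_def.mpr (by omega))]
    simp [fmat, hij]
end
end
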